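/- arXiv:2209.14079 — 2 statements merged into one kernel-verified Lean document; each statement's English description precedes it below -/
import Mathlib

section
/- Edge subdivision respects biconnectivity. Let G be a finite simple graph on V with adjacent vertices a and b, and let G' be the simple graph on V ⊕ Unit obtained by subdividing the edge {a, b}: for u, v : V, inl u and inl v are adjacent in G' iff G.Adj u v and {u, v} ≠ {a, b}; inl u and the new vertex inr () are adjacent iff u = a or u = b; and inr () is not adjacent to itself. Then for all u, v : V with u ≠ v and {u, v} ≠ {a, b}: u and v are biconnected in G if and only if inl u and inl v are biconnected in G'. -/
/-- Vertices `u` and `v` are biconnected in `H`: they are distinct, connected by a walk,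
and remain connected after removal of any vertex other than `u` and `v`. -/
def Biconnected {V : Type*} (H : SimpleGraph V) (u v : V) : Prop :=
  u ≠ v ∧ Nonempty (H.Walk u v) ∧
    ∀ w : V, w ∉ ({u, v} : Set V) → ∃ p : H.Walk u v, w ∉ p.support

/-- A walk in `G` lifts to its edge subdivision `G'`, staying inside a vertex set `P` that contains
the new vertex as soon as it contains both ends of the subdivided edge. -/
theorem exists_walk_subdivision {V : Type*} {G : SimpleGraph V} {a b : V}
    {G' : SimpleGraph (V ⊕ Unit)}
    (h₁ : ∀ u v : V, G'.Adj (Sum.inl u) (Sum.inl v) ↔ (G.Adj u v ∧ s(u, v) ≠ s(a, b)))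
    (h₂ : ∀ u : V, G'.Adj (Sum.inl u) (Sum.inr ()) ↔ (u = a ∨ u = b))
    {P : V ⊕ Unit → Prop} (hP : P (Sum.inl a) → P (Sum.inl b) → P (Sum.inr ()))
    {u v : V} (p : G.Walk u v) (hp : ∀ x ∈ p.support, P (Sum.inl x)) :
    ∃ q : G'.Walk (Sum.inl u) (Sum.inl v), ∀ x ∈ q.support, P x := by
  induction p with
  | nil => exact ⟨.nil, by simpa using hp⟩
  | @cons x y z h p ih =>
    simp only [SimpleGraph.Walk.support_cons, List.mem_cons, forall_eq_or_imp] at hp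
    obtain ⟨q, hq⟩ := ih hp.2
    have hy := hp.2 y p.start_mem_support
    by_cases he : s(x, y) = s(a, b)
    · have hxy : (x = a ∧ y = b) ∨ (x = b ∧ y = a) := by simpa using he
      have hx' : G'.Adj (Sum.inl x) (Sum.inr ()) := (h₂ x).2 (by tauto)
      have hy' : G'.Adj (Sum.inr ()) (Sum.inl y) := ((h₂ y).2 (by tauto)).symm
      have hn : P (Sum.inr ()) := by
        rcases hxy with ⟨rfl, rfl⟩ | ⟨rfl, rfl⟩
        · exact hP hp.1 hy
        · exact hP hy hp.1
      refine ⟨.cons hx' (.cons hy' q), ?_⟩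
      simp only [SimpleGraph.Walk.support_cons, List.mem_cons, forall_eq_or_imp]
      exact ⟨hp.1, hn, hq⟩
    · refine ⟨.cons ((h₁ x y).2 ⟨h, he⟩) q, ?_⟩
      simp only [SimpleGraph.Walk.support_cons, List.mem_cons, forall_eq_or_imp]
      exact ⟨hp.1, hq⟩

/-- A walk in the edge subdivision `G'` of `G` projects to `G`; if it starts at the new vertex, the
projection may start at either end of the subdivided edge. -/
theorem exists_walk_of_subdivision {V : Type*} {G : SimpleGraph V} {a b : V} (hab : G.Adj a b)
    {G' : SimpleGraph (V ⊕ Unit)}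
    (h₁ : ∀ u v : V, G'.Adj (Sum.inl u) (Sum.inl v) ↔ (G.Adj u v ∧ s(u, v) ≠ s(a, b)))
    (h₂ : ∀ u : V, G'.Adj (Sum.inl u) (Sum.inr ()) ↔ (u = a ∨ u = b))
    {P : V → Prop} {x y : V ⊕ Unit} (p : G'.Walk x y)
    (hp : ∀ z, Sum.inl z ∈ p.support → P z) {u v : V} (hv : y = Sum.inl v) (hu : P u)
    (hx : x = Sum.inl u ∨ x = Sum.inr () ∧ (u = a ∨ u = b)) :
    ∃ q : G.Walk u v, ∀ z ∈ q.support, P z := by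
  induction p generalizing u with
  | nil =>
    subst hv
    obtain rfl : v = u := by simpa using hx
    exact ⟨.nil, by simpa using hu⟩
  | @cons x y z h p ih =>
    have hp' : ∀ z, Sum.inl z ∈ p.support → P z := fun z hz => hp z (by simp [hz])
    rcases y with d | _
    · have hd : P d := hp' d p.start_mem_support
      obtain ⟨q, hq⟩ := ih hp' hv hd (Or.inl rfl)
      have hud : u = d ∨ G.Adj u d := by
        rcases hx with rfl | ⟨rfl, hc⟩
        · exact Or.inr ((h₁ u d).1 h).1
        · rcases hc with rfl | rfl <;> rcases (h₂ d).1 h.symm with rfl | rfl <;>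
            simp [hab, hab.symm]
      rcases hud with rfl | hud
      · exact ⟨q, hq⟩
      · exact ⟨.cons hud q, by simpa using ⟨hu, hq⟩⟩
    · rcases hx with rfl | ⟨rfl, -⟩
      · exact ih hp' hv hu (Or.inr ⟨rfl, (h₂ u).1 h⟩)
      · exact (G'.irrefl h).elim

theorem stmt_8 {V : Type*} [Fintype V] (G : SimpleGraph V) {a b : V} (hab : G.Adj a b)
    (G' : SimpleGraph (V ⊕ Unit))
    (h₁ : ∀ u v : V, G'.Adj (Sum.inl u) (Sum.inl v) ↔ (G.Adj u v ∧ s(u, v) ≠ s(a, b)))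
    (h₂ : ∀ u : V, G'.Adj (Sum.inl u) (Sum.inr ()) ↔ (u = a ∨ u = b)) :
    ∀ u v : V, u ≠ v → s(u, v) ≠ s(a, b) →
      (Biconnected G u v ↔ Biconnected G' (Sum.inl u) (Sum.inl v)) := by
  intro u v huv he
  constructor
  · rintro ⟨-, ⟨p⟩, hw⟩
    refine ⟨by simpa using huv, ?_, ?_⟩
    · obtain ⟨q, -⟩ := exists_walk_subdivision h₁ h₂ (P := fun _ => True) (by simp) p (by simp)
      exact ⟨q⟩
    · rintro (w | _) hne
      · obtain ⟨p, hp⟩ := hw w (by simpa using hne)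
        obtain ⟨q, hq⟩ := exists_walk_subdivision h₁ h₂ (P := fun x => x ≠ Sum.inl w)
          (by simp) p (by rintro x hx ⟨⟩; exact hp hx)
        exact ⟨q, fun h => hq _ h rfl⟩
      · obtain ⟨c, hc, hcab⟩ : ∃ c, c ∉ ({u, v} : Set V) ∧ (c = a ∨ c = b) := by
          by_contra! h
          have ha : a ∈ ({u, v} : Set V) := by
            by_contra ha
            exact (h a ha).1 rfl
          have hb : b ∈ ({u, v} : Set V) := by
            by_contra hb
            exact (h b hb).2 rfl
          have := hab.ne
          simp only [Set.mem_insert_iff, Set.mem_singleton_iff] at ha hb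
          apply he
          rcases ha with rfl | rfl <;> rcases hb with rfl | rfl <;> simp_all
        obtain ⟨p, hp⟩ := hw c hc
        obtain ⟨q, hq⟩ := exists_walk_subdivision h₁ h₂
          (P := fun x => x ≠ Sum.inl c ∧ x ≠ Sum.inr ())
          (by rcases hcab with rfl | rfl <;> simp) p
          (fun x hx => ⟨by rintro ⟨⟩; exact hp hx, by simp⟩)
        exact ⟨q, fun h => (hq _ h).2 rfl⟩
  · rintro ⟨-, ⟨p⟩, hw⟩
    refine ⟨huv, ?_, fun w hne => ?_⟩
    · obtain ⟨q, -⟩ := exists_walk_of_subdivision hab h₁ h₂ (P := fun _ => True) p (by simp) rfl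
        trivial (Or.inl rfl)
      exact ⟨q⟩
    · obtain ⟨p, hp⟩ := hw (Sum.inl w) (by simpa using hne)
      obtain ⟨q, hq⟩ := exists_walk_of_subdivision hab h₁ h₂ (P := fun x => x ≠ w) p
        (by rintro x hx rfl; exact hp hx) rfl (by rintro rfl; simp at hne) (Or.inl rfl)
      exact ⟨q, fun h => hq _ h rfl⟩
end

section
/- Lying on a common cycle is a transitive relation on edges: let G be a finite simple graph and let e₁, e₂, e₃ be edges of G. If there exists a cycle in G whose edge list contains both e₁ and e₂, and there exists a cycle in G whose edge list contains both e₂ and e₃, then there exists a cycle in G whose edge list contains both e₁ and e₃. (This is the fact, used throughout the paper, that 2-vertex-connectivity is an equivalence relation on the edges of a graph.) -/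
namespace SimpleGraph.Walk

variable {V : Type*} {G : SimpleGraph V}

/-- A walk meeting a set splits at the first vertex of that set. -/
lemma exists_append_first_mem (S : Set V) {v u : V} (p : G.Walk v u)
    (hp : ∃ w ∈ p.support, w ∈ S) :
    ∃ (a : V) (q : G.Walk v a) (r : G.Walk a u), p = q.append r ∧ a ∈ S ∧
      ∀ x ∈ q.support, x ∈ S → x = a := by
  induction p with
  | nil =>
    obtain ⟨w, hw, hwS⟩ := hp
    rw [support_nil, List.mem_singleton] at hw
    subst hw
    exact ⟨w, nil, nil, rfl, hwS, by simp⟩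
  | @cons v v' u h p ih =>
    by_cases hv : v ∈ S
    · exact ⟨v, nil, cons h p, rfl, hv, by simp⟩
    · obtain ⟨w, hw, hwS⟩ := hp
      rw [support_cons, List.mem_cons] at hw
      obtain rfl | hw := hw
      · exact absurd hwS hv
      · obtain ⟨a, q, r, rfl, ha, hq⟩ := ih ⟨w, hw, hwS⟩
        refine ⟨a, cons h q, r, rfl, ha, fun x hx hxS => ?_⟩
        rw [support_cons, List.mem_cons] at hx
        obtain rfl | hx := hx
        · exact absurd hxS hv
        · exact hq x hx hxS

/-- A walk through an edge splits at that edge. -/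
lemma exists_append_cons_of_mem_edges {x y : V} (c : G.Walk x y) {e : Sym2 V}
    (he : e ∈ c.edges) :
    ∃ (u v : V) (h : G.Adj u v) (q : G.Walk x u) (r : G.Walk v y),
      e = s(u, v) ∧ c = q.append (cons h r) := by
  induction c with
  | nil => simp at he
  | @cons x x' y h c ih =>
    rw [edges_cons, List.mem_cons] at he
    obtain rfl | he := he
    · exact ⟨x, x', h, nil, c, rfl, rfl⟩
    · obtain ⟨u, v, h', q, r, rfl, rfl⟩ := ih he
      exact ⟨u, v, h', cons h q, r, rfl, rfl⟩

/-- Removing an edge from a cycle leaves a path. -/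
lemma IsCycle.exists_isPath_of_mem_edges {x : V} {c : G.Walk x x} (hc : c.IsCycle) {e : Sym2 V}
    (he : e ∈ c.edges) :
    ∃ (u v : V) (_ : G.Adj u v) (p : G.Walk v u), e = s(u, v) ∧ p.IsPath ∧
      (∀ f, f ∈ c.edges ↔ f = e ∨ f ∈ p.edges) ∧ ∀ w, w ∈ c.support ↔ w ∈ p.support := by
  obtain ⟨u, v, h, q, r, rfl, rfl⟩ := c.exists_append_cons_of_mem_edges he
  refine ⟨u, v, h, r.append q, rfl, ?_, ?_, ?_⟩
  · have := hc.support_nodup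
    rw [tail_support_append, support_cons, List.tail_cons] at this
    rw [isPath_def, support_append]
    exact (List.perm_append_comm.nodup_iff).1 this
  · intro f
    simp only [edges_append, edges_cons, List.mem_append, List.mem_cons]
    tauto
  · intro w
    simp only [mem_support_append_iff, support_cons, List.mem_cons]
    have := q.end_mem_support
    constructor
    · rintro (h | rfl | h) <;> tauto
    · tauto

/-- If a cycle meets a set in two vertices, then each of its edges lies on an arc of the cycle that
joins two distinct vertices of the set and has no interior vertex in the set. -/
lemma IsCycle.exists_arc {x : V} {c : G.Walk x x} (hc : c.IsCycle) {e : Sym2 V}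
    (he : e ∈ c.edges) (S : Set V) {y z : V} (hyz : y ≠ z) (hy : y ∈ c.support)
    (hz : z ∈ c.support) (hyS : y ∈ S) (hzS : z ∈ S) :
    ∃ (a b : V) (Q : G.Walk b a), a ∈ S ∧ b ∈ S ∧ a ≠ b ∧ Q.IsPath ∧ e ∈ Q.edges ∧
      Q.edges ⊆ c.edges ∧ Q.support ⊆ c.support ∧
      ∀ w ∈ Q.support, w ∈ S → w = a ∨ w = b := by
  obtain ⟨u, v, h, p, rfl, hp, hpe, hps⟩ := hc.exists_isPath_of_mem_edges he
  obtain ⟨a, q, r, rfl, ha, hq⟩ := p.exists_append_first_mem S ⟨y, (hps y).1 hy, hyS⟩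
  obtain ⟨b, t', s', hrev, hb, ht'⟩ :=
    r.reverse.exists_append_first_mem S ⟨a, by simp, ha⟩
  obtain ⟨s, t, rfl, ht⟩ : ∃ (s : G.Walk a b) (t : G.Walk b u), r = s.append t ∧
      ∀ w ∈ t.support, w ∈ S → w = b := by
    refine ⟨s'.reverse, t'.reverse, ?_, by simpa using ht'⟩
    rw [← reverse_append, ← hrev, reverse_reverse]
  have hab : a ≠ b := by
    rintro rfl
    have hs : s = nil := (isPath_iff_nil.1 hp.of_append_right.of_append_left).eq_nil
    subst hs
    have key : ∀ w ∈ c.support, w ∈ S → w = a := by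
      intro w hw hwS
      rw [hps, nil_append, mem_support_append_iff] at hw
      exact hw.elim (fun hw => hq w hw hwS) fun hw => ht w hw hwS
    exact hyz ((key y hy hyS).trans (key z hz hzS).symm)
  refine ⟨a, b, t.append (cons h q), ha, hb, hab, ?_, by simp, ?_, ?_, ?_⟩
  · have hn := hp.support_nodup
    have hbs : b ∈ s.support.tail := (s.mem_support_iff.1 s.end_mem_support).resolve_left hab.symm
    rw [support_append, tail_support_append] at hn
    rw [isPath_def, support_append, support_cons, List.tail_cons, ← t.cons_tail_support]
    grind
  · intro f hf
    rw [hpe]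
    simp only [edges_append, edges_cons, List.mem_append, List.mem_cons] at hf ⊢
    tauto
  · intro w hw
    rw [hps]
    have := q.start_mem_support
    have := t.end_mem_support
    simp only [mem_support_append_iff, support_cons, List.mem_cons] at hw ⊢
    obtain hw | rfl | hw := hw <;> tauto
  · intro w hw hwS
    simp only [mem_support_append_iff, support_cons, List.mem_cons] at hw
    obtain hw | rfl | hw := hw
    · exact .inr (ht w hw hwS)
    · exact .inr (ht w t.end_mem_support hwS)
    · exact .inl (hq w hw hwS)

/-- Two paths with the same ends, no common interior vertex and different edges form a cycle. -/
lemma IsPath.isCycle_append_of_mem_edges {a b : V} {P : G.Walk a b} {Q : G.Walk b a}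
    (hP : P.IsPath) (hQ : Q.IsPath) (hab : a ≠ b)
    (hPQ : ∀ w ∈ P.support, w ∈ Q.support → w = a ∨ w = b)
    {e : Sym2 V} (heQ : e ∈ Q.edges) (heP : e ∉ P.edges) : (P.append Q).IsCycle := by
  refine hP.isCycle_append hQ (fun w hwP hwQ => ?_) ?_
  · have hP' := hP.support_nodup
    have hQ' := hQ.support_nodup
    rw [← P.cons_tail_support] at hP' hPQ
    rw [← Q.cons_tail_support] at hQ' hPQ
    grind
  · by_contra! hlen
    cases P with
    | nil => exact hab rfl
    | cons h P =>
      cases Q with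
      | nil => exact hab rfl
      | cons h' Q =>
        cases P with
        | cons => simp at hlen
        | nil =>
          cases Q with
          | cons => simp at hlen
          | nil => exact heP (by simpa [Sym2.eq_swap] using heQ)

end SimpleGraph.Walk

theorem stmt_12 {V : Type*} [Fintype V] (G : SimpleGraph V)
    (e₁ e₂ e₃ : Sym2 V) (he₁ : e₁ ∈ G.edgeSet) (he₂ : e₂ ∈ G.edgeSet)
    (he₃ : e₃ ∈ G.edgeSet)
    (h₁₂ : ∃ (x : V) (c : G.Walk x x), c.IsCycle ∧ e₁ ∈ c.edges ∧ e₂ ∈ c.edges)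
    (h₂₃ : ∃ (x : V) (c : G.Walk x x), c.IsCycle ∧ e₂ ∈ c.edges ∧ e₃ ∈ c.edges) :
    ∃ (x : V) (c : G.Walk x x), c.IsCycle ∧ e₁ ∈ c.edges ∧ e₃ ∈ c.edges := by
  obtain ⟨x₁, c₁, hc₁, h₁, h₂⟩ := h₁₂
  obtain ⟨x₂, c₂, hc₂, h₂', h₃⟩ := h₂₃
  by_cases h₃' : e₃ ∈ c₁.edges
  · exact ⟨x₁, c₁, hc₁, h₁, h₃'⟩
  induction e₂ with | _ y z
  have hyz : y ≠ z := (G.mem_edgeSet.1 he₂).ne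
  obtain ⟨a, b, Q, ha, hb, hab, hQ, heQ, -, -, hQS⟩ :=
    hc₂.exists_arc h₃ {w | w ∈ c₁.support} hyz (c₂.fst_mem_support_of_mem_edges h₂')
      (c₂.snd_mem_support_of_mem_edges h₂') (c₁.fst_mem_support_of_mem_edges h₂)
      (c₁.snd_mem_support_of_mem_edges h₂)
  obtain ⟨P, hP, heP, hPe, hPs⟩ : ∃ P : G.Walk a b, P.IsPath ∧ e₁ ∈ P.edges ∧
      P.edges ⊆ c₁.edges ∧ P.support ⊆ c₁.support := by
    obtain ⟨a', b', P, ha', hb', hab', hP, heP, hPe, hPs, -⟩ :=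
      hc₁.exists_arc h₁ {a, b} hab ha hb (by simp) (by simp)
    obtain ⟨rfl, rfl⟩ | ⟨rfl, rfl⟩ : (a' = a ∧ b' = b) ∨ (a' = b ∧ b' = a) := by
      simp only [Set.mem_insert_iff, Set.mem_singleton_iff] at ha' hb'
      grind
    · exact ⟨P.reverse, hP.reverse, by simpa using heP, by simpa using hPe, by simpa using hPs⟩
    · exact ⟨P, hP, heP, hPe, hPs⟩
  refine ⟨a, P.append Q, hP.isCycle_append_of_mem_edges hQ hab (fun w hw hw' => hQS w hw' (hPs hw)) heQ
    fun h => h₃' (hPe h), ?_, ?_⟩ <;> simp [heP, heQ]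
end
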